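/- Let Λ be a right 4-Nakayama artin algebra and let M be a finitely generated indecomposable local right Λ-module. If M is 4-factor serial, then l(M) = 5. -/

import Mathlib

/-! Basic definitions for (right) modules over a ring: radical, socle, length,
uniserial, local, indecomposable, `n`-factor serial, right `n`-Nakayama algebras,
Nakayama algebras and almost split sequences. -/

universe u v w

section ModuleDefs

variable (A : Type v) [Ring A] (M : Type w) [AddCommGroup M] [Module A M]

/-- The composition length of a module, i.e. the Krull dimension of its submodule lattice. -/
noncomputable def moduleLength : WithBot ℕ∞ := Order.krullDim (Submodule A M)

/-- The radical of a module: the intersection of all its maximal submodules. -/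
def moduleRad : Submodule A M := sInf {N : Submodule A M | IsCoatom N}

/-- The socle of a module: the sum of all its simple submodules. -/
def moduleSoc : Submodule A M := sSup {N : Submodule A M | IsAtom N}

variable {A M}

/-- The radical of a submodule `N`, viewed as a submodule of the ambient module. -/
def radOf (N : Submodule A M) : Submodule A M :=
  Submodule.map N.subtype (moduleRad A ↥N)

/-- The socle of a submodule `N`, viewed as a submodule of the ambient module. -/
def socOf (N : Submodule A M) : Submodule A M :=
  Submodule.map N.subtype (moduleSoc A ↥N)

variable (A M)

/-- The iterated radical `rad^n(M)`, as a submodule of `M`. -/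
def radPow : ℕ → Submodule A M
  | 0 => ⊤
  | n + 1 => radOf (radPow n)

/-- A module is uniserial if its submodules are totally ordered by inclusion. -/
def IsUniserialModule : Prop := ∀ N P : Submodule A M, N ≤ P ∨ P ≤ N

/-- A module is local if it has a unique maximal submodule. -/
def IsLocalModule : Prop := ∃! N : Submodule A M, IsCoatom N

/-- A module is colocal if its socle is a simple submodule. -/
def IsColocalModule : Prop := IsAtom (moduleSoc A M)

/-- A module is indecomposable if it is nonzero and is not the direct sum of two
nonzero submodules. -/
def IsIndecModule : Prop :=
  Nontrivial M ∧ ∀ N P : Submodule A M, IsCompl N P → N = ⊥ ∨ P = ⊥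

/-- The Loewy length of a module: the least `n` with `rad^n(M) = 0`. -/
noncomputable def loewyLength : ℕ := sInf {n : ℕ | radPow A M n = ⊥}

/-- A module `M` of length `l` is `n`-factor serial (`l ≥ n > 1`) if it is not uniserial,
`M/rad^{l-n}(M)` is uniserial and `M/rad^{l-n+1}(M)` is not uniserial. -/
def IsNFactorSerial (n : ℕ) : Prop :=
  1 < n ∧ ¬ IsUniserialModule A M ∧
  ∃ l : ℕ, moduleLength A M = l ∧ n ≤ l ∧
    IsUniserialModule A (M ⧸ radPow A M (l - n)) ∧
    ¬ IsUniserialModule A (M ⧸ radPow A M (l - n + 1))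

/-- `M` is `n`-factor serial, where `1`-factor serial means uniserial. -/
def IsFactorSerial (n : ℕ) : Prop :=
  (n = 1 ∧ IsUniserialModule A M) ∨ IsNFactorSerial A M n

end ModuleDefs

section AlgebraDefs

variable (Λ : Type u) [Ring Λ]

/-- A ring `Λ` is right `n`-Nakayama if every finitely generated indecomposable right
`Λ`-module is `i`-factor serial for some `1 ≤ i ≤ n`, and there is at least one finitely
generated indecomposable `n`-factor serial right `Λ`-module.  Right `Λ`-modules are
realized as left `Λᵐᵒᵖ`-modules. -/
def IsRightNNakayama (n : ℕ) : Prop :=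
  (∀ M : ModuleCat.{u} Λᵐᵒᵖ, Module.Finite Λᵐᵒᵖ M → IsIndecModule Λᵐᵒᵖ M →
      ∃ i, 1 ≤ i ∧ i ≤ n ∧ IsFactorSerial Λᵐᵒᵖ M i) ∧
  ∃ M : ModuleCat.{u} Λᵐᵒᵖ, Module.Finite Λᵐᵒᵖ M ∧ IsIndecModule Λᵐᵒᵖ M ∧
    IsNFactorSerial Λᵐᵒᵖ M n

/-- A ring `Λ` is a Nakayama algebra if every finitely generated indecomposable projective
right `Λ`-module and every finitely generated indecomposable projective left `Λ`-module is
uniserial. -/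
def IsNakayamaAlgebra : Prop :=
  (∀ M : ModuleCat.{u} Λᵐᵒᵖ, Module.Finite Λᵐᵒᵖ M → Module.Projective Λᵐᵒᵖ M →
      IsIndecModule Λᵐᵒᵖ M → IsUniserialModule Λᵐᵒᵖ M) ∧
  (∀ M : ModuleCat.{u} Λ, Module.Finite Λ M → Module.Projective Λ M →
      IsIndecModule Λ M → IsUniserialModule Λ M)

end AlgebraDefs

section AlmostSplit

variable {A : Type v} [Ring A]

/-- A pair of maps `f : X → Y`, `g : Y → Z` is an almost split (Auslander-Reiten) sequence
if `0 → X → Y → Z → 0` is a non-split short exact sequence with `X` and `Z` indecomposable,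
such that every homomorphism `V → Z` from a finitely generated module which is not a split
epimorphism factors through `g`. -/
def IsAlmostSplitSequence {X Y Z : Type w} [AddCommGroup X] [Module A X]
    [AddCommGroup Y] [Module A Y] [AddCommGroup Z] [Module A Z]
    (f : X →ₗ[A] Y) (g : Y →ₗ[A] Z) : Prop :=
  Function.Injective f ∧ Function.Surjective g ∧ LinearMap.range f = LinearMap.ker g ∧
  (¬ ∃ s : Z →ₗ[A] Y, g ∘ₗ s = LinearMap.id) ∧
  IsIndecModule A X ∧ IsIndecModule A Z ∧
  ∀ V : ModuleCat.{w} A, Module.Finite A V →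
    ∀ h : V →ₗ[A] Z, (¬ ∃ s : Z →ₗ[A] V, h ∘ₗ s = LinearMap.id) →
      ∃ k : V →ₗ[A] Y, g ∘ₗ k = h

end AlmostSplit

section Radical

variable {A : Type*} [Ring A] {M : Type*} [AddCommGroup M] [Module A M]

theorem moduleRad_eq_jacobson_smul_top [IsArtinianRing A] :
    moduleRad A M = Ring.jacobson A • (⊤ : Submodule A M) := by
  apply le_antisymm
  · refine Module.jacobson_le_of_eq_bot ?_
    have h : Module.IsTorsionBySet A (M ⧸ Ring.jacobson A • (⊤ : Submodule A M))
        (Ring.jacobson A) := by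
      rw [Module.isTorsionBySet_quotient_iff]
      exact fun m i hi ↦ Submodule.smul_mem_smul hi trivial
    let _ := h.module
    have := (h.semilinearMap.isSemisimpleModule_iff_of_bijective Function.bijective_id).2
      inferInstance
    exact IsSemisimpleModule.jacobson_eq_bot A _
  · exact Ring.jacobson_smul_top_le A M

theorem radOf_eq_jacobson_smul [IsArtinianRing A] (N : Submodule A M) :
    radOf N = Ring.jacobson A • N := by
  rw [radOf, moduleRad_eq_jacobson_smul_top, Submodule.map_smul'', Submodule.map_top,
    Submodule.range_subtype]

theorem radPow_succ_eq [IsArtinianRing A] (n : ℕ) :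
    radPow A M (n + 1) = Ring.jacobson A • radPow A M n :=
  radOf_eq_jacobson_smul _

theorem Submodule.jacobson_smul_le (N : Submodule A M) : Ring.jacobson A • N ≤ N :=
  Submodule.smul_le.mpr fun r _ _ hn ↦ N.smul_mem r hn

theorem radPow_antitone [IsArtinianRing A] : Antitone (radPow A M) :=
  antitone_nat_of_succ_le fun n ↦ by
    rw [radPow_succ_eq]
    exact Submodule.jacobson_smul_le _

theorem covBy_map_subtype {N : Submodule A M} {C : Submodule A N} (hC : IsCoatom C) :
    C.map N.subtype ⋖ N :=
  Set.Iic.isCoatom_iff.mp ((N.mapIic.isCoatom_iff C).mpr hC)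

theorem jacobson_smul_le_of_covBy {N D : Submodule A M} (h : D ⋖ N) :
    Ring.jacobson A • N ≤ D := by
  have hD : IsCoatom (N.mapIic.symm ⟨D, h.le⟩) :=
    (N.mapIic.symm.isCoatom_iff _).mpr (Set.Iic.isCoatom_iff.mpr h)
  have h1 : Ring.jacobson A • (⊤ : Submodule A N) ≤ N.mapIic.symm ⟨D, h.le⟩ :=
    (Ring.jacobson_smul_top_le A N).trans (sInf_le hD)
  have h2 := N.mapIic.monotone h1
  rw [OrderIso.apply_symm_apply, ← Subtype.coe_le_coe, Submodule.coe_mapIic_apply,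
    Submodule.map_smul'', Submodule.map_top, Submodule.range_subtype] at h2
  exact h2

/-- If `N` has at most one maximal submodule, then every proper submodule of `N` lies in the
radical of `N`. -/
theorem eq_or_le_jacobson_smul [IsArtinianRing A] [IsNoetherian A M] {N : Submodule A M}
    (h : ∀ D D' : Submodule A M, D ⋖ N → D' ⋖ N → D = D') {P : Submodule A M} (hP : P ≤ N) :
    P = N ∨ P ≤ Ring.jacobson A • N := by
  rw [← radOf_eq_jacobson_smul]
  refine or_iff_not_imp_left.mpr fun hne ↦ ?_
  obtain h0 | ⟨C, hC, hPC⟩ := eq_top_or_exists_le_coatom (P.comap N.subtype)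
  · exact absurd (le_antisymm hP (Submodule.comap_subtype_eq_top.mp h0)) hne
  · have h1 : C ≤ moduleRad A N := le_sInf fun C' hC' ↦
      (Submodule.map_injective_of_injective N.injective_subtype
        (h _ _ (covBy_map_subtype hC) (covBy_map_subtype hC'))).le
    have h2 := Submodule.map_mono (f := N.subtype) (hPC.trans h1)
    rwa [Submodule.map_comap_subtype, inf_eq_right.mpr hP] at h2

theorem isUniserialModule_quotient_iff (W : Submodule A M) :
    IsUniserialModule A (M ⧸ W) ↔ ∀ P P' : Submodule A M, W ≤ P → W ≤ P' → P ≤ P' ∨ P' ≤ P := by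
  constructor
  · intro h P P' hP hP'
    have key : ∀ {S T : Submodule A M}, W ≤ T → S.map W.mkQ ≤ T.map W.mkQ → S ≤ T := by
      intro S T hT hST
      rw [Submodule.map_le_iff_le_comap, Submodule.comap_map_mkQ, sup_eq_right.mpr hT] at hST
      exact hST
    exact (h (P.map W.mkQ) (P'.map W.mkQ)).imp (key hP') (key hP)
  · intro h P P'
    have key : ∀ {S T : Submodule A (M ⧸ W)}, S.comap W.mkQ ≤ T.comap W.mkQ → S ≤ T :=
      fun h ↦ (Submodule.comap_le_comap_iff_of_surjective W.mkQ_surjective).mp h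
    exact (h _ _ (W.le_comap_mkQ P) (W.le_comap_mkQ P')).imp key key

theorem eq_or_le_radPow_succ [IsArtinianRing A] [IsNoetherian A M] {m n : ℕ}
    (h : IsUniserialModule A (M ⧸ radPow A M m)) (hn : n < m) {P : Submodule A M}
    (hP : P ≤ radPow A M n) : P = radPow A M n ∨ P ≤ radPow A M (n + 1) := by
  rw [radPow_succ_eq]
  refine eq_or_le_jacobson_smul (fun D D' hD hD' ↦ ?_) hP
  have hm : ∀ {D}, D ⋖ radPow A M n → radPow A M m ≤ D := fun hD ↦
    ((radPow_antitone hn).trans (radPow_succ_eq n).le).trans (jacobson_smul_le_of_covBy hD)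
  rcases (isUniserialModule_quotient_iff _).mp h D D' (hm hD) (hm hD') with h1 | h1
  · exact (h1.eq_or_lt).resolve_right fun h2 ↦ hD.2 h2 hD'.lt
  · exact ((h1.eq_or_lt).resolve_right fun h2 ↦ hD'.2 h2 hD.lt).symm

theorem isUniserialModule_quotient_radPow {m : ℕ}
    (h : ∀ n < m, ∀ P ≤ radPow A M n, P = radPow A M n ∨ P ≤ radPow A M (n + 1)) :
    IsUniserialModule A (M ⧸ radPow A M m) := by
  have key : ∀ P : Submodule A M, ∀ n ≤ m, P ≤ radPow A M n ∨ ∃ i < n, P = radPow A M i := by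
    intro P n
    induction n with
    | zero => exact fun _ ↦ Or.inl le_top
    | succ n ih =>
      intro hn
      rcases ih (by omega) with h1 | ⟨i, hi, h1⟩
      · rcases h n (by omega) P h1 with h2 | h2
        · exact Or.inr ⟨n, by omega, h2⟩
        · exact Or.inl h2
      · exact Or.inr ⟨i, by omega, h1⟩
  have anti : ∀ i ≤ m, ∀ j, i ≤ j → radPow A M j ≤ radPow A M i := by
    intro i _ j hij
    induction j, hij using Nat.le_induction with
    | base => exact le_rfl
    | succ j _ ih => exact (Submodule.map_subtype_le _ _).trans ih
  rw [isUniserialModule_quotient_iff]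
  intro P P' hP hP'
  rcases key P m le_rfl with h1 | ⟨i, hi, rfl⟩
  · exact Or.inl (h1.trans hP')
  rcases key P' m le_rfl with h1 | ⟨j, hj, rfl⟩
  · exact Or.inr (h1.trans hP)
  rcases le_total i j with h1 | h1
  · exact Or.inr (anti i hi.le j h1)
  · exact Or.inl (anti j hj.le i h1)

end Radical

section Subquotient

variable {A : Type*} [Ring A] {V : Type*} [AddCommGroup V] [Module A V] {K Y : Submodule A V}

/-- The submodules of the subquotient `Y / K` are the submodules between `K` and `Y`. -/
def subquotientOrderIso (hK : K ≤ Y) :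
    Submodule A (Y ⧸ K.comap Y.subtype) ≃o Set.Icc K Y where
  toFun S := ⟨(S.comap (K.comap Y.subtype).mkQ).map Y.subtype,
    by
      have h := Submodule.map_mono (f := Y.subtype) ((K.comap Y.subtype).le_comap_mkQ S)
      rwa [Submodule.map_comap_subtype, inf_eq_right.mpr hK] at h,
    Submodule.map_subtype_le _ _⟩
  invFun E := (E.1.comap Y.subtype).map (K.comap Y.subtype).mkQ
  left_inv S := by
    dsimp only
    rw [Submodule.comap_map_eq_of_injective Y.injective_subtype,
      Submodule.map_comap_eq_of_surjective (Submodule.mkQ_surjective _)]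
  right_inv E := by
    ext1
    dsimp only
    rw [Submodule.comap_map_mkQ, sup_eq_right.mpr (Submodule.comap_mono E.2.1),
      Submodule.map_comap_subtype, inf_eq_right.mpr E.2.2]
  map_rel_iff' {S T} := by
    rw [← Subtype.coe_le_coe]
    exact (Submodule.map_le_map_iff_of_injective Y.injective_subtype _ _).trans
      (Submodule.comap_le_comap_iff_of_surjective (Submodule.mkQ_surjective _))

theorem isIndecModule_subquotient (hK : K < Y)
    (h : ∀ P P' : Submodule A V, K ≤ P → P ≤ Y → K ≤ P' → P' ≤ Y → P ⊓ P' ≤ K → Y ≤ P ⊔ P' →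
      P ≤ K ∨ P' ≤ K) :
    IsIndecModule A (Y ⧸ K.comap Y.subtype) := by
  let e := subquotientOrderIso hK.le
  have hbot : ∀ S, (e S).1 ≤ K → S = ⊥ := by
    intro S hS
    rw [eq_bot_iff, ← e.le_iff_le]
    exact Subtype.coe_le_coe.mp (hS.trans (e ⊥).2.1)
  constructor
  · rw [Submodule.Quotient.nontrivial_iff, Ne,
      Submodule.comap_subtype_eq_top]
    exact hK.not_ge
  · intro S T hST
    refine (h (e S).1 (e T).1 (e S).2.1 (e S).2.2 (e T).2.1 (e T).2.2 ?_ ?_).imp (hbot S) (hbot T)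
    · let E : Set.Icc K Y := ⟨(e S).1 ⊓ (e T).1, le_inf (e S).2.1 (e T).2.1,
        inf_le_left.trans (e S).2.2⟩
      have h1 : e.symm E ≤ ⊥ := hST.disjoint ((e.symm_apply_le).mpr inf_le_left)
        ((e.symm_apply_le).mpr inf_le_right)
      have h2 : e.symm E ≤ e.symm ⟨K, le_rfl, hK.le⟩ := h1.trans bot_le
      exact e.symm.le_iff_le.mp h2
    · let E : Set.Icc K Y := ⟨(e S).1 ⊔ (e T).1, (e S).2.1.trans le_sup_left,
        sup_le (e S).2.2 (e T).2.2⟩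
      have h1 : ⊤ ≤ e.symm E := hST.codisjoint ((e.le_symm_apply).mpr le_sup_left)
        ((e.le_symm_apply).mpr le_sup_right)
      have h2 : e.symm ⟨Y, hK.le, le_rfl⟩ ≤ e.symm E := le_top.trans h1
      exact e.symm.le_iff_le.mp h2

theorem le_moduleLength_subquotient {n : ℕ} {f : ℕ → Submodule A V}
    (hf : ∀ i < n, f i < f (i + 1)) (h0 : f 0 = K) (hn : f n = Y) :
    (n : WithBot ℕ∞) ≤ moduleLength A (Y ⧸ K.comap Y.subtype) := by
  have hmono : ∀ i j, i ≤ j → j ≤ n → f i ≤ f j := by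
    intro i j hij
    induction j, hij using Nat.le_induction with
    | base => exact fun _ ↦ le_rfl
    | succ j _ ih => exact fun hj ↦ (ih (by omega)).trans (hf j (by omega)).le
  have hK : K ≤ Y := h0 ▸ hn ▸ hmono 0 n (Nat.zero_le n) le_rfl
  let e := subquotientOrderIso hK
  let s : LTSeries (Submodule A (Y ⧸ K.comap Y.subtype)) :=
    { length := n
      toFun := fun i ↦ e.symm ⟨f i, h0 ▸ hmono 0 i (Nat.zero_le _) (by omega),
        hn ▸ hmono i n (by omega) le_rfl⟩
      step := fun i ↦ e.symm.lt_iff_lt.mpr (hf i i.2) }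
  exact Order.LTSeries.length_le_krullDim s

/-- If `E` and `F` are incomparable and contain the radical of `Y`, then no quotient of `Y / K` by
a positive power of its radical is uniserial. -/
theorem not_isUniserialModule_subquotient [IsArtinianRing A] (hK : K ≤ Y) {E F : Submodule A V}
    (hKE : K ≤ E) (hE : E ≤ Y) (hKF : K ≤ F) (hF : F ≤ Y) (hJE : Ring.jacobson A • Y ≤ E)
    (hJF : Ring.jacobson A • Y ≤ F) (hEF : ¬ E ≤ F) (hFE : ¬ F ≤ E) {n : ℕ} (hn : 1 ≤ n) :
    ¬ IsUniserialModule A ((Y ⧸ K.comap Y.subtype) ⧸ radPow A (Y ⧸ K.comap Y.subtype) n) := by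
  let e := subquotientOrderIso hK
  have hrad : ∀ G : Set.Icc K Y, Ring.jacobson A • Y ≤ G.1 →
      radPow A (Y ⧸ K.comap Y.subtype) n ≤ e.symm G := by
    intro G hG
    refine (radPow_antitone hn).trans ?_
    rw [radPow_succ_eq, Submodule.smul_le]
    intro r hr x _
    obtain ⟨y, rfl⟩ := Submodule.mkQ_surjective _ x
    exact ⟨r • y, hG (Submodule.smul_mem_smul hr y.2), rfl⟩
  rw [isUniserialModule_quotient_iff]
  intro h
  rcases h _ _ (hrad ⟨E, hKE, hE⟩ hJE) (hrad ⟨F, hKF, hF⟩ hJF) with h1 | h1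
  · exact hEF (e.symm.le_iff_le.mp h1)
  · exact hFE (e.symm.le_iff_le.mp h1)

end Subquotient

section FiberProduct

variable {A : Type*} [Ring A] {M : Type*} [AddCommGroup M] [Module A M]

/-- The pairs of elements of `L` that are congruent modulo `N`. -/
def congruentPairs (L N : Submodule A M) : Submodule A (M × M) :=
  L.prod L ⊓ N.comap (LinearMap.fst A M M - LinearMap.snd A M M)

theorem prod_le_congruentPairs {L N : Submodule A M} (h : N ≤ L) :
    N.prod N ≤ congruentPairs L N :=
  fun _ hp ↦ ⟨⟨h hp.1, h hp.2⟩, N.sub_mem hp.1 hp.2⟩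

variable {L N Q C D : Submodule A M}

theorem prod_le_of_exists_notMem (hLN : Ring.jacobson A • L = N) (hNQ : Ring.jacobson A • N = Q)
    (hL : ∀ P ≤ L, P = L ∨ P ≤ N) (hC : C ⋖ Q) (hD : D ⋖ Q) (hCD : C ≠ D)
    {P : Submodule A (M × M)} (hCP : C.prod D ≤ P) (hP : P ≤ congruentPairs L N)
    (hPN : ∃ p ∈ P, p.1 ∉ N) : Q.prod Q ≤ P := by
  obtain ⟨p, hp, hpN⟩ := hPN
  have h1 : P.map (LinearMap.fst A M M) = L := by
    refine (hL _ ?_).resolve_right fun h ↦ hpN (h ⟨p, hp, rfl⟩)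
    rintro _ ⟨x, hx, rfl⟩
    exact (hP hx).1.1
  have h2 : P.map (LinearMap.snd A M M) = L := by
    refine (hL _ ?_).resolve_right fun h ↦ hpN ?_
    · rintro _ ⟨x, hx, rfl⟩
      exact (hP hx).1.2
    · have := N.add_mem (hP hp).2 (h ⟨p, hp, rfl⟩)
      simpa using this
  let J := Ring.jacobson A
  have h3 : (J • J • P).map (LinearMap.fst A M M) = Q := by
    rw [Submodule.map_smul'', Submodule.map_smul'', h1, hLN, hNQ]
  have h4 : (J • J • P).map (LinearMap.snd A M M) = Q := by
    rw [Submodule.map_smul'', Submodule.map_smul'', h2, hLN, hNQ]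
  have h5 : ∀ x ∈ J • J • P, x.1 - x.2 ∈ J • Q := by
    have h : (J • J • P).map (LinearMap.fst A M M - LinearMap.snd A M M) ≤ J • Q := by
      rw [Submodule.map_smul'', Submodule.map_smul'', ← hNQ]
      refine smul_mono_right _ (smul_mono_right _ ?_)
      rintro _ ⟨x, hx, rfl⟩
      exact (hP hx).2
    exact fun x hx ↦ h ⟨x, hx, rfl⟩
  have hJP : J • J • P ≤ P :=
    (Submodule.jacobson_smul_le _).trans (Submodule.jacobson_smul_le _)
  have hJC : J • Q ≤ C := jacobson_smul_le_of_covBy hC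
  have hJD : J • Q ≤ D := jacobson_smul_le_of_covBy hD
  have h6 : Q ≤ P.comap (LinearMap.inr A M M) := by
    obtain ⟨a, haC, haD⟩ := SetLike.not_le_iff_exists.mp
      fun h : C ≤ D ↦ hC.2 (lt_of_le_of_ne h hCD) hD.lt
    obtain ⟨x, hx, rfl⟩ := h3.ge (hC.le haC)
    have hx2 : x.2 ∉ D := fun h ↦ haD (by simpa using D.add_mem (hJD (h5 x hx)) h)
    have hxP : (0, x.2) ∈ P := by
      have h : (0, x.2) = x - (x.1, 0) := by ext <;> simp
      exact h ▸ P.sub_mem (hJP hx) (hCP ⟨haC, D.zero_mem⟩)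
    have hlt : D < P.comap (LinearMap.inr A M M) ⊓ Q :=
      lt_of_le_of_ne (le_inf (fun d hd ↦ hCP ⟨C.zero_mem, hd⟩) hD.le)
        fun h ↦ hx2 (h.ge ⟨hxP, h4.le ⟨x, hx, rfl⟩⟩)
    exact inf_eq_right.mp (inf_le_right.eq_or_lt.resolve_right (hD.2 hlt))
  have h7 : Q ≤ P.comap (LinearMap.inl A M M) := by
    obtain ⟨a, haD, haC⟩ := SetLike.not_le_iff_exists.mp
      fun h : D ≤ C ↦ hD.2 (lt_of_le_of_ne h hCD.symm) hC.lt
    obtain ⟨x, hx, rfl⟩ := h4.ge (hD.le haD)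
    have hx1 : x.1 ∉ C := fun h ↦ haC (by simpa using C.sub_mem h (hJC (h5 x hx)))
    have hxP : (x.1, 0) ∈ P := by
      have h : (x.1, 0) = x - (0, x.2) := by ext <;> simp
      exact h ▸ P.sub_mem (hJP hx) (hCP ⟨C.zero_mem, haD⟩)
    have hlt : C < P.comap (LinearMap.inl A M M) ⊓ Q :=
      lt_of_le_of_ne (le_inf (fun d hd ↦ hCP ⟨hd, D.zero_mem⟩) hC.le)
        fun h ↦ hx1 (h.ge ⟨hxP, h3.le ⟨x, hx, rfl⟩⟩)
    exact inf_eq_right.mp (inf_le_right.eq_or_lt.resolve_right (hC.2 hlt))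
  intro q hq
  simpa using P.add_mem (h7 hq.1) (h6 hq.2)

theorem le_prod_of_inf_le (hLN : Ring.jacobson A • L = N) (hNQ : Ring.jacobson A • N = Q)
    (hL : ∀ P ≤ L, P = L ∨ P ≤ N) (hN : ∀ P ≤ N, P = N ∨ P ≤ Q)
    (hC : C ⋖ Q) (hD : D ⋖ Q) (hCD : C ≠ D) {P P' : Submodule A (M × M)}
    (hCP : C.prod D ≤ P) (hP : P ≤ congruentPairs L N) (hCP' : C.prod D ≤ P')
    (hP' : P' ≤ congruentPairs L N) (hPP' : P ⊓ P' ≤ C.prod D) (hPN : ∃ p ∈ P, p.1 ∉ N) :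
    P' ≤ C.prod D := by
  have hQP := prod_le_of_exists_notMem hLN hNQ hL hC hD hCD hCP hP hPN
  have hQP' : P' ⊓ Q.prod Q ≤ C.prod D := (le_inf (inf_le_right.trans hQP) inf_le_left).trans hPP'
  obtain ⟨a, haQ, haC⟩ := SetLike.exists_of_lt hC.lt
  obtain ⟨b, hbQ, hbD⟩ := SetLike.exists_of_lt hD.lt
  have h1 : ∀ p ∈ P', p.1 ∈ N := by
    by_contra! h
    have h2 := prod_le_of_exists_notMem hLN hNQ hL hC hD hCD hCP' hP' h
    have h3 : (a, 0) ∈ Q.prod Q := ⟨haQ, Q.zero_mem⟩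
    exact haC (hQP' ⟨h2 h3, h3⟩).1
  have h2 : ∀ p ∈ P', p.2 ∈ N := fun p hp ↦ by
    simpa using N.sub_mem (h1 p hp) (hP' hp).2
  have hf : P'.map (LinearMap.fst A M M) ≤ N := by
    rintro _ ⟨x, hx, rfl⟩
    exact h1 x hx
  have hs : P'.map (LinearMap.snd A M M) ≤ N := by
    rintro _ ⟨x, hx, rfl⟩
    exact h2 x hx
  have hJ : ∀ x ∈ Ring.jacobson A • P', x ∈ C.prod D := by
    intro x hx
    refine hQP' ⟨Submodule.jacobson_smul_le _ hx, ?_, ?_⟩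
    · have h : (Ring.jacobson A • P').map (LinearMap.fst A M M) ≤ Q := by
        rw [Submodule.map_smul'', ← hNQ]
        exact smul_mono_right _ hf
      exact h ⟨x, hx, rfl⟩
    · have h : (Ring.jacobson A • P').map (LinearMap.snd A M M) ≤ Q := by
        rw [Submodule.map_smul'', ← hNQ]
        exact smul_mono_right _ hs
      exact h ⟨x, hx, rfl⟩
  have hfQ : P'.map (LinearMap.fst A M M) ≤ Q := by
    refine (hN _ hf).resolve_left fun h ↦ ?_
    have h3 : (Ring.jacobson A • P').map (LinearMap.fst A M M) = Q := by
      rw [Submodule.map_smul'', h, hNQ]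
    obtain ⟨x, hx, rfl⟩ := h3.ge haQ
    exact haC (hJ x hx).1
  have hsQ : P'.map (LinearMap.snd A M M) ≤ Q := by
    refine (hN _ hs).resolve_left fun h ↦ ?_
    have h3 : (Ring.jacobson A • P').map (LinearMap.snd A M M) = Q := by
      rw [Submodule.map_smul'', h, hNQ]
    obtain ⟨x, hx, rfl⟩ := h3.ge hbQ
    exact hbD (hJ x hx).2
  exact fun x hx ↦ hQP' ⟨hx, hfQ ⟨x, hx, rfl⟩, hsQ ⟨x, hx, rfl⟩⟩

theorem isIndecModule_fiberProduct (hLN : Ring.jacobson A • L = N)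
    (hNQ : Ring.jacobson A • N = Q) (hNL : N < L) (hQN : Q < N)
    (hL : ∀ P ≤ L, P = L ∨ P ≤ N) (hN : ∀ P ≤ N, P = N ∨ P ≤ Q)
    (hC : C ⋖ Q) (hD : D ⋖ Q) (hCD : C ≠ D) :
    IsIndecModule A (congruentPairs L N ⧸ (C.prod D).comap (congruentPairs L N).subtype) := by
  obtain ⟨l, hlL, hlN⟩ := SetLike.exists_of_lt hNL
  have hl : (l, l) ∈ congruentPairs L N := ⟨⟨hlL, hlL⟩, by simp⟩
  have hle : C.prod D ≤ Q.prod Q := Submodule.prod_mono hC.le hD.le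
  have hQY : Q.prod Q ≤ congruentPairs L N :=
    (Submodule.prod_mono hQN.le hQN.le).trans (prod_le_congruentPairs hNL.le)
  refine isIndecModule_subquotient (lt_of_le_of_ne (hle.trans hQY) ?_) ?_
  · exact fun h ↦ hlN (hQN.le (hle (h.ge hl)).1)
  intro P P' hCP hP hCP' hP' hinf hsup
  by_cases h : ∃ p ∈ P, p.1 ∉ N
  · exact Or.inr (le_prod_of_inf_le hLN hNQ hL hN hC hD hCD hCP hP hCP' hP' hinf h)
  by_cases h' : ∃ p ∈ P', p.1 ∉ N
  · exact Or.inl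
      (le_prod_of_inf_le hLN hNQ hL hN hC hD hCD hCP' hP' hCP hP (inf_comm P P' ▸ hinf) h')
  push Not at h h'
  have h1 : P ⊔ P' ≤ N.comap (LinearMap.fst A M M) := sup_le h h'
  exact absurd (h1 (hsup hl)) hlN

theorem five_le_moduleLength_fiberProduct (hNL : N < L) (hQN : Q < N) (hC : C < Q) (hD : D < Q) :
    (5 : WithBot ℕ∞) ≤
      moduleLength A (congruentPairs L N ⧸ (C.prod D).comap (congruentPairs L N).subtype) := by
  obtain ⟨l, hlL, hlN⟩ := SetLike.exists_of_lt hNL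
  obtain ⟨n, hnN, hnQ⟩ := SetLike.exists_of_lt hQN
  obtain ⟨c, hcQ, hcC⟩ := SetLike.exists_of_lt hC
  obtain ⟨d, hdQ, hdD⟩ := SetLike.exists_of_lt hD
  have h0 : C.prod D < Q.prod D := lt_of_le_of_ne (Submodule.prod_mono hC.le le_rfl) fun h ↦
    hcC (h.ge (show (c, 0) ∈ Q.prod D from ⟨hcQ, D.zero_mem⟩)).1
  have h1 : Q.prod D < Q.prod Q := lt_of_le_of_ne (Submodule.prod_mono le_rfl hD.le) fun h ↦
    hdD (h.ge (show (0, d) ∈ Q.prod Q from ⟨Q.zero_mem, hdQ⟩)).2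
  have h2 : Q.prod Q < N.prod Q := lt_of_le_of_ne (Submodule.prod_mono hQN.le le_rfl) fun h ↦
    hnQ (h.ge (show (n, 0) ∈ N.prod Q from ⟨hnN, Q.zero_mem⟩)).1
  have h3 : N.prod Q < N.prod N := lt_of_le_of_ne (Submodule.prod_mono le_rfl hQN.le) fun h ↦
    hnQ (h.ge (show (0, n) ∈ N.prod N from ⟨N.zero_mem, hnN⟩)).2
  have h4 : N.prod N < congruentPairs L N := lt_of_le_of_ne (prod_le_congruentPairs hNL.le) fun h ↦
    hlN (h.ge (show (l, l) ∈ congruentPairs L N from ⟨⟨hlL, hlL⟩, by simp⟩)).1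
  let f : ℕ → Submodule A (M × M)
    | 0 => C.prod D
    | 1 => Q.prod D
    | 2 => Q.prod Q
    | 3 => N.prod Q
    | 4 => N.prod N
    | _ => congruentPairs L N
  refine le_moduleLength_subquotient (n := 5) (f := f) (fun i hi ↦ ?_) rfl rfl
  interval_cases i
  exacts [h0, h1, h2, h3, h4]

theorem not_isUniserialModule_fiberProduct [IsArtinianRing A] (hLN : Ring.jacobson A • L = N)
    (hNQ : Ring.jacobson A • N = Q) (hNL : N < L) (hQN : Q < N) (hC : C ≤ Q) (hD : D ≤ Q)
    {n : ℕ} (hn : 1 ≤ n) :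
    let X := congruentPairs L N ⧸ (C.prod D).comap (congruentPairs L N).subtype
    ¬ IsUniserialModule A (X ⧸ radPow A X n) := by
  obtain ⟨l, hlL, hlN⟩ := SetLike.exists_of_lt hNL
  obtain ⟨m, hmN, hmQ⟩ := SetLike.exists_of_lt hQN
  have hKN : C.prod D ≤ N.prod N := Submodule.prod_mono (hC.trans hQN.le) (hD.trans hQN.le)
  have hEY : N.prod N ≤ congruentPairs L N := prod_le_congruentPairs hNL.le
  refine not_isUniserialModule_subquotient (E := N.prod N) (F := congruentPairs L Q)
    (hKN.trans hEY) hKN hEY ?_ ?_ ?_ ?_ ?_ ?_ hn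
  · exact (Submodule.prod_mono hC hD).trans (prod_le_congruentPairs (hQN.le.trans hNL.le))
  · exact fun p hp ↦ ⟨hp.1, hQN.le hp.2⟩
  · rw [Submodule.smul_le]
    rintro r hr p hp
    exact hLN ▸ ⟨Submodule.smul_mem_smul hr hp.1.1, Submodule.smul_mem_smul hr hp.1.2⟩
  · rw [Submodule.smul_le]
    rintro r hr p hp
    refine ⟨⟨L.smul_mem r hp.1.1, L.smul_mem r hp.1.2⟩, ?_⟩
    rw [SetLike.mem_coe, Submodule.mem_comap, map_smul]
    exact hNQ ▸ Submodule.smul_mem_smul hr hp.2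
  · exact fun h ↦ hmQ (by simpa using (h (show (m, 0) ∈ N.prod N from ⟨hmN, N.zero_mem⟩)).2)
  · exact fun h ↦ hlN (h (show (l, l) ∈ congruentPairs L Q from ⟨⟨hlL, hlL⟩, by simp⟩)).1

theorem not_isFactorSerial_fiberProduct [IsArtinianRing A] (hLN : Ring.jacobson A • L = N)
    (hNQ : Ring.jacobson A • N = Q) (hNL : N < L) (hQN : Q < N) (hC : C < Q) (hD : D < Q)
    {i : ℕ} (hi : i ≤ 4) :
    ¬ IsFactorSerial A (congruentPairs L N ⧸ (C.prod D).comap (congruentPairs L N).subtype) i := by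
  have hlen := five_le_moduleLength_fiberProduct hNL hQN hC hD
  have hrad (n : ℕ) (hn : 1 ≤ n) :=
    not_isUniserialModule_fiberProduct hLN hNQ hNL hQN hC.le hD.le hn
  rintro (⟨-, h⟩ | ⟨-, -, l, hl, -, h, -⟩)
  · refine hrad 1 le_rfl ((isUniserialModule_quotient_iff _).mpr fun P P' _ _ ↦ h P P')
  · rw [hl] at hlen
    have : 5 ≤ l := by exact_mod_cast hlen
    exact hrad (l - i) (by omega) h

end FiberProduct

theorem exists_covBy_radPow_of_not_isUniserialModule {A : Type*} [Ring A] [IsArtinianRing A]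
    {M : Type*} [AddCommGroup M] [Module A M] [IsNoetherian A M] {k : ℕ}
    (h : IsUniserialModule A (M ⧸ radPow A M k))
    (h' : ¬ IsUniserialModule A (M ⧸ radPow A M (k + 1))) :
    ∃ C D, C ⋖ radPow A M k ∧ D ⋖ radPow A M k ∧ C ≠ D := by
  by_contra! hCD
  refine h' (isUniserialModule_quotient_radPow fun n hn P hP ↦ ?_)
  rcases Nat.lt_succ_iff_lt_or_eq.mp hn with hn | rfl
  · exact eq_or_le_radPow_succ h hn hP
  · rw [radPow_succ_eq]
    exact eq_or_le_jacobson_smul hCD hP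

theorem length_of_local_four_factor_serial
    (R : Type*) [CommRing R] [IsArtinianRing R]
    (Λ : Type u) [Ring Λ] [Algebra R Λ] [Module.Finite R Λ]
    (hΛ : IsRightNNakayama Λ 4)
    (M : Type u) [AddCommGroup M] [Module Λᵐᵒᵖ M] [Module.Finite Λᵐᵒᵖ M]
    (hind : IsIndecModule Λᵐᵒᵖ M) (hloc : IsLocalModule Λᵐᵒᵖ M)
    (hfs : IsNFactorSerial Λᵐᵒᵖ M 4) :
    moduleLength Λᵐᵒᵖ M = 5 := by
  have : IsArtinianRing Λᵐᵒᵖ := .of_finite R Λᵐᵒᵖ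
  obtain ⟨-, -, l, hl, h4, hu, hnu⟩ := hfs
  obtain ⟨C, D, hC, hD, hCD⟩ := exists_covBy_radPow_of_not_isUniserialModule hu hnu
  obtain ⟨k, rfl⟩ : ∃ k, l = k + 4 := ⟨l - 4, by omega⟩
  rw [Nat.add_sub_cancel] at hu hC hD
  match k with
  | 0 =>
    exact absurd (hloc.unique (covBy_top_iff.mp hC) (covBy_top_iff.mp hD)) hCD
  | 1 => exact_mod_cast hl
  | k + 2 =>
    have hlt : ∀ {n : ℕ}, radPow Λᵐᵒᵖ M (n + 1) ≠ ⊥ →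
        radPow Λᵐᵒᵖ M (n + 1) < radPow Λᵐᵒᵖ M n := by
      intro n hn
      rw [radPow_succ_eq]
      refine Submodule.FG.jacobson_smul_lt ?_ (IsNoetherian.noetherian _)
      exact ne_bot_of_le_ne_bot hn (radPow_antitone n.le_succ)
    have hQ : radPow Λᵐᵒᵖ M (k + 2) ≠ ⊥ := hC.lt.ne_bot
    have hQN := hlt hQ
    have hNL := hlt hQN.ne_bot
    have hLN := (radPow_succ_eq (A := Λᵐᵒᵖ) (M := M) k).symm
    have hNQ := (radPow_succ_eq (A := Λᵐᵒᵖ) (M := M) (k + 1)).symm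
    obtain ⟨i, -, hi, hX⟩ := hΛ.1 (ModuleCat.of Λᵐᵒᵖ _) inferInstance
      (isIndecModule_fiberProduct hLN hNQ hNL hQN
        (fun P hP ↦ eq_or_le_radPow_succ hu (by omega) hP)
        (fun P hP ↦ eq_or_le_radPow_succ hu (by omega) hP) hC hD hCD)
    exact absurd hX (not_isFactorSerial_fiberProduct hLN hNQ hNL hQN hC.lt hD.lt hi)
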